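/- Suppose S is a nonnegative random variable with 0 < E[S] < ∞. Then for all p ≥ 1, all t ≥ 1, and all θ > 0, E[(N_o(t) + 1)^p] ≤ exp(θ) (100p / (1 − E[exp(−θS)]))^{p+2} t^p. -/

import Mathlib

open MeasureTheory ProbabilityTheory
open scoped ENNReal

/-- The number of renewals in `[0, t]` of a renewal process whose successive renewal
intervals are `ξ 0, ξ 1, ξ 2, ...`. -/
noncomputable def renewalCount (ξ : ℕ → ℝ) (t : ℝ) : ℕ :=
  sSup {n : ℕ | ∑ i ∈ Finset.range n, ξ i ≤ t}

theorem aux_exp_le_sum (s : ℝ) (N : ℕ) :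
    Real.exp (s * N) = 1 + ∑ n ∈ Finset.range N,
      (1 - Real.exp (-s)) * Real.exp (s * ((n + 1 : ℕ) : ℝ)) := by
  induction N with
  | zero => simp
  | succ k ih =>
    rw [Finset.sum_range_succ, ← add_assoc, ← ih, sub_mul, ← Real.exp_add]
    have : -s + s * ((k + 1 : ℕ) : ℝ) = s * k := by push_cast; ring
    rw [this]; ring

theorem aux_count_le (ξ : ℕ → ℝ) (hξ : ∀ i, 0 ≤ ξ i) (t : ℝ) (n : ℕ)
    (h : n < renewalCount ξ t) : ∑ i ∈ Finset.range (n + 1), ξ i ≤ t := by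
  unfold renewalCount at h
  set A := {n : ℕ | ∑ i ∈ Finset.range n, ξ i ≤ t} with hA
  have hb : BddAbove A := by
    by_contra hb
    rw [Nat.sSup_of_not_bddAbove hb] at h
    omega
  have hne : A.Nonempty := by
    by_contra hne
    rw [Set.not_nonempty_iff_eq_empty] at hne
    rw [hne] at h
    simp at h
  have hm : ∑ i ∈ Finset.range (sSup A), ξ i ≤ t := Nat.sSup_mem hne hb
  refine le_trans (Finset.sum_le_sum_of_subset_of_nonneg ?_ ?_) hm
  · intro x hx
    simp only [Finset.mem_range] at *
    omega
  · intros; exact hξ _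

theorem aux_pointwise (ξ : ℕ → ℝ) (hξ : ∀ i, 0 ≤ ξ i) (t s θ : ℝ) (ht : 0 < t) (hs : 0 < s)
    (hθ : 0 < θ) :
    ENNReal.ofReal (Real.exp (s * (renewalCount ξ t : ℝ))) ≤ 1 + ∑' n : ℕ,
      ENNReal.ofReal ((1 - Real.exp (-s)) * Real.exp θ * Real.exp (s * n) *
        Real.exp ((-(θ / t)) * ∑ i ∈ Finset.range n, ξ i)) := by
  have h1 : 0 ≤ 1 - Real.exp (-s) := by
    have : Real.exp (-s) ≤ 1 := Real.exp_le_one_iff.2 (by linarith)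
    linarith
  rw [aux_exp_le_sum, ENNReal.ofReal_add zero_le_one
    (Finset.sum_nonneg fun i _ => mul_nonneg h1 (Real.exp_pos _).le), ENNReal.ofReal_one]
  gcongr
  rw [ENNReal.ofReal_sum_of_nonneg (fun i _ => mul_nonneg h1 (Real.exp_pos _).le)]
  set f : ℕ → ℝ≥0∞ := fun n => ENNReal.ofReal ((1 - Real.exp (-s)) * Real.exp θ * Real.exp (s * n) *
        Real.exp ((-(θ / t)) * ∑ i ∈ Finset.range n, ξ i)) with hf
  calc _ ≤ ∑ n ∈ Finset.range (renewalCount ξ t), f (n + 1) := by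
        refine Finset.sum_le_sum fun n hn => ENNReal.ofReal_le_ofReal ?_
        have h2 := aux_count_le ξ hξ t n (Finset.mem_range.1 hn)
        have h3 : 1 ≤ Real.exp (θ + (-(θ / t)) * ∑ i ∈ Finset.range (n + 1), ξ i) := by
          apply Real.one_le_exp
          have : θ / t * ∑ i ∈ Finset.range (n + 1), ξ i ≤ θ / t * t := by gcongr
          rw [div_mul_cancel₀ _ ht.ne'] at this
          linarith
        rw [Real.exp_add] at h3
        have h4 : 0 ≤ (1 - Real.exp (-s)) * Real.exp (s * ((n + 1 : ℕ) : ℝ)) :=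
          mul_nonneg h1 (Real.exp_pos _).le
        have := mul_le_mul_of_nonneg_left h3 h4
        rw [mul_one] at this
        refine this.trans (le_of_eq ?_)
        ring
    _ ≤ ∑' n, f (n + 1) := ENNReal.sum_le_tsum _
    _ ≤ ∑' n, f n := ENNReal.tsum_comp_le_tsum_of_injective (add_left_injective 1) f

/-- Explicit bound on the `p`-th moment of `N_o(t) + 1` for `t ≥ 1`, where `N_o` is the
counting process of an ordinary renewal process with i.i.d. renewal intervals `Sseq i`
distributed as `S`, with `S ≥ 0` and `0 < E[S] < ∞`. -/
theorem ordinary_renewal_moment_general_time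
    {Ω : Type*} [MeasurableSpace Ω] (μ : Measure Ω) [IsProbabilityMeasure μ]
    (S : Ω → ℝ) (hSmeas : Measurable S) (hSnn : ∀ᵐ ω ∂μ, 0 ≤ S ω)
    (hSint : Integrable S μ) (hES : 0 < ∫ ω, S ω ∂μ)
    (Sseq : ℕ → Ω → ℝ)
    (hmeas : ∀ i, Measurable (Sseq i))
    (hindep : iIndepFun Sseq μ)
    (hlaw : ∀ i, μ.map (Sseq i) = μ.map S) :
    ∀ p : ℝ, 1 ≤ p → ∀ t : ℝ, 1 ≤ t → ∀ θ : ℝ, 0 < θ →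
      ∫⁻ ω, ENNReal.ofReal (((renewalCount (fun i => Sseq i ω) t : ℝ) + 1) ^ p) ∂μ
        ≤ ENNReal.ofReal (Real.exp θ
            * (100 * p / (1 - ∫ ω, Real.exp (-θ * S ω) ∂μ)) ^ (p + 2) * t ^ p) := by
  intro p hp t ht θ hθ
  have ht0 : 0 < t := by linarith
  -- integrability of exponentials
  have hexpint : ∀ c : ℝ, 0 ≤ c → Integrable (fun ω => Real.exp (-c * S ω)) μ := by
    intro c hc
    refine Integrable.of_bound (by fun_prop) 1 ?_
    filter_upwards [hSnn] with ω hω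
    rw [Real.norm_eq_abs, abs_of_pos (Real.exp_pos _)]
    apply Real.exp_le_one_iff.2
    nlinarith [mul_nonneg hc hω]
  set L := ∫ ω, Real.exp (-θ * S ω) ∂μ with hL
  have hL0 : 0 ≤ L := integral_nonneg fun _ => (Real.exp_pos _).le
  have hL1 : L < 1 := by
    have hnn : 0 ≤ᵐ[μ] fun ω => 1 - Real.exp (-θ * S ω) := by
      filter_upwards [hSnn] with ω hω
      have : Real.exp (-θ * S ω) ≤ 1 := Real.exp_le_one_iff.2 (by nlinarith [mul_nonneg hθ.le hω])
      simp only [Pi.zero_apply]; linarith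
    have hint : Integrable (fun ω => 1 - Real.exp (-θ * S ω)) μ :=
      (integrable_const 1).sub (hexpint θ hθ.le)
    have hval : ∫ ω, (1 - Real.exp (-θ * S ω)) ∂μ = 1 - L := by
      rw [integral_sub (integrable_const 1) (hexpint θ hθ.le)]; simp [hL]
    have h0 := integral_nonneg_of_ae hnn
    rw [hval] at h0
    rcases h0.lt_or_eq with h | h
    · linarith
    · exfalso
      rw [← hval] at h
      have h2 := (integral_eq_zero_iff_of_nonneg_ae hnn hint).1 h.symm
      have h3 : S =ᵐ[μ] fun _ => 0 := by
        filter_upwards [h2] with ω hω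
        simp only [Pi.zero_apply] at hω
        have : Real.exp (-θ * S ω) = 1 := by linarith
        rw [Real.exp_eq_one_iff] at this
        rcases mul_eq_zero.1 this with h | h
        · linarith
        · exact h
      rw [integral_congr_ae h3] at hES
      simp at hES
  set a := 1 - L with ha
  have ha0 : 0 < a := by linarith
  have ha1 : a ≤ 1 := by linarith
  obtain ⟨s, hs⟩ : ∃ s, s = a / (2 * t) := ⟨_, rfl⟩
  have hs0 : 0 < s := by rw [hs]; positivity
  have hs1 : s ≤ 1 / 2 := by
    rw [hs, div_le_div_iff₀ (by positivity) (by norm_num)]; nlinarith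
  -- the Laplace transform at θ / t
  set lam := ∫ ω, Real.exp (-(θ / t) * S ω) ∂μ with hlam
  have hlam0 : 0 ≤ lam := integral_nonneg fun _ => (Real.exp_pos _).le
  have hlam1 : lam ≤ Real.exp (-(2 * s)) := by
    have h1 : lam ≤ ∫ ω, ((1 / t) * Real.exp (-θ * S ω) + (1 - 1 / t)) ∂μ := by
      refine integral_mono (hexpint _ (by positivity))
        (((hexpint θ hθ.le).const_mul _).add (integrable_const _)) ?_
      intro ω
      have h1t : 1 / t ≤ 1 := by rw [div_le_one ht0]; exact ht
      have := convexOn_exp.2 (Set.mem_univ (-θ * S ω)) (Set.mem_univ (0 : ℝ))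
        (by positivity : 0 ≤ 1 / t) (by linarith : 0 ≤ 1 - 1 / t) (by ring)
      simp only [smul_eq_mul, mul_zero, add_zero, Real.exp_zero, mul_one] at this
      have e : -(θ / t) * S ω = 1 / t * (-θ * S ω) := by ring
      simp only [e]
      exact this
    rw [integral_add ((hexpint θ hθ.le).const_mul _) (integrable_const _),
      integral_const_mul, ← hL] at h1
    simp only [integral_const, probReal_univ, one_smul] at h1
    have h2 : 1 / t * L + (1 - 1 / t) = -(2 * s) + 1 := by
      rw [hs, ha]; field_simp; ring
    rw [h2] at h1
    exact h1.trans (Real.add_one_le_exp _)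
  have hident : ∀ i, IdentDistrib (Sseq i) S μ μ := fun i =>
    ⟨(hmeas i).aemeasurable, hSmeas.aemeasurable, hlaw i⟩
  have hnn : ∀ᵐ ω ∂μ, ∀ i, 0 ≤ Sseq i ω := by
    rw [ae_all_iff]
    intro i
    exact (hident i).symm.ae_snd (p := fun x => 0 ≤ x) measurableSet_Ici hSnn
  have hlap : ∀ n : ℕ, ∫⁻ ω, ENNReal.ofReal
      (Real.exp (-(θ / t) * ∑ i ∈ Finset.range n, Sseq i ω)) ∂μ = ENNReal.ofReal (lam ^ n) := by
    intro n
    have hi : Integrable (fun ω => Real.exp (-(θ / t) * ∑ i ∈ Finset.range n, Sseq i ω)) μ := by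
      refine Integrable.of_bound (by fun_prop) 1 ?_
      filter_upwards [hnn] with ω hω
      rw [Real.norm_eq_abs, abs_of_pos (Real.exp_pos _)]
      apply Real.exp_le_one_iff.2
      have : 0 ≤ θ / t * ∑ i ∈ Finset.range n, Sseq i ω :=
        mul_nonneg (by positivity) (Finset.sum_nonneg fun i _ => hω i)
      linarith
    rw [← ofReal_integral_eq_lintegral_ofReal hi (ae_of_all _ fun _ => (Real.exp_pos _).le)]
    congr 1
    have h1 := hindep.mgf_sum hmeas (Finset.range n) (t := -(θ / t))
    have h2 : ∀ i, mgf (Sseq i) μ (-(θ / t)) = lam := by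
      intro i
      rw [mgf_congr_identDistrib (hident i)]
      rfl
    simp only [h2, Finset.prod_const, Finset.card_range] at h1
    rw [← h1]
    simp [mgf]
  have hes : 0 < 1 - Real.exp (-s) := by
    have : Real.exp (-s) < 1 := Real.exp_lt_one_iff.2 (by linarith)
    linarith
  -- exponential moment
  have hmom : ∫⁻ ω, ENNReal.ofReal
      (Real.exp (s * (renewalCount (fun i => Sseq i ω) t : ℝ))) ∂μ
      ≤ 1 + ENNReal.ofReal (Real.exp θ) := by
    calc _ ≤ ∫⁻ ω, (1 + ∑' n : ℕ,
          ENNReal.ofReal ((1 - Real.exp (-s)) * Real.exp θ * Real.exp (s * n) *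
          Real.exp ((-(θ / t)) * ∑ i ∈ Finset.range n, Sseq i ω))) ∂μ := by
          refine lintegral_mono_ae ?_
          filter_upwards [hnn] with ω hω
          exact aux_pointwise (fun i => Sseq i ω) hω t s θ ht0 hs0 hθ
      _ = 1 + ∑' n : ℕ, ENNReal.ofReal ((1 - Real.exp (-s)) * Real.exp θ * Real.exp (s * n)) *
            ENNReal.ofReal (lam ^ n) := by
          rw [lintegral_add_left measurable_const, lintegral_tsum (fun n => by fun_prop)]
          congr 1
          · simp
          · refine tsum_congr fun n => ?_
            rw [← hlap n, ← lintegral_const_mul _ (by fun_prop)]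
            refine lintegral_congr fun ω => ?_
            rw [ENNReal.ofReal_mul (by positivity)]
      _ ≤ 1 + ∑' n : ℕ, ENNReal.ofReal ((1 - Real.exp (-s)) * Real.exp θ * Real.exp (-s) ^ n) := by
          gcongr with n
          rw [← ENNReal.ofReal_mul (by positivity)]
          apply ENNReal.ofReal_le_ofReal
          rw [mul_assoc]
          refine mul_le_mul_of_nonneg_left ?_ (by positivity)
          rw [mul_comm s, Real.exp_nat_mul, ← mul_pow]
          refine pow_le_pow_left₀ (by positivity) ?_ n
          calc Real.exp s * lam ≤ Real.exp s * Real.exp (-(2 * s)) := by gcongr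
            _ = Real.exp (-s) := by rw [← Real.exp_add]; congr 1; ring
      _ = 1 + ENNReal.ofReal (Real.exp θ) := by
          have hlt : Real.exp (-s) < 1 := by linarith
          rw [← ENNReal.ofReal_tsum_of_nonneg (fun n => by positivity)
            ((summable_geometric_of_lt_one (Real.exp_pos _).le hlt).mul_left _), tsum_mul_left,
            tsum_geometric_of_lt_one (Real.exp_pos _).le hlt]
          congr 2
          field_simp
  have hp0 : 0 < p := by linarith
  calc _ ≤ ∫⁻ ω, ENNReal.ofReal ((p / s) ^ p * Real.exp s) * ENNReal.ofReal
            (Real.exp (s * (renewalCount (fun i => Sseq i ω) t : ℝ))) ∂μ := by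
        refine lintegral_mono fun ω => ?_
        rw [← ENNReal.ofReal_mul (by positivity)]
        apply ENNReal.ofReal_le_ofReal
        set N : ℝ := (renewalCount (fun i => Sseq i ω) t : ℝ)
        have hN : 0 ≤ N := Nat.cast_nonneg _
        have h1 : N + 1 ≤ (p / s) * Real.exp (s * (N + 1) / p) := by
          have h2 : s * (N + 1) / p ≤ Real.exp (s * (N + 1) / p) := by
            have := Real.add_one_le_exp (s * (N + 1) / p)
            linarith
          calc N + 1 = (p / s) * (s * (N + 1) / p) := by field_simp
            _ ≤ _ := by gcongr
        calc (N + 1) ^ p ≤ ((p / s) * Real.exp (s * (N + 1) / p)) ^ p :=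
              Real.rpow_le_rpow (by positivity) h1 hp0.le
          _ = (p / s) ^ p * Real.exp s * Real.exp (s * N) := by
              rw [Real.mul_rpow (by positivity) (by positivity), ← Real.exp_mul,
                div_mul_cancel₀ _ hp0.ne', mul_assoc, ← Real.exp_add]
              congr 2; ring
    _ ≤ ENNReal.ofReal ((p / s) ^ p * Real.exp s) * (1 + ENNReal.ofReal (Real.exp θ)) := by
        rw [lintegral_const_mul' _ _ ENNReal.ofReal_ne_top]
        gcongr
    _ ≤ _ := by
        rw [← ENNReal.ofReal_one, ← ENNReal.ofReal_add zero_le_one (Real.exp_pos _).le,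
          ← ENNReal.ofReal_mul (by positivity)]
        apply ENNReal.ofReal_le_ofReal
        have e1 : 1 + Real.exp θ ≤ 2 * Real.exp θ := by
          have := Real.one_le_exp hθ.le
          linarith
        have e2 : Real.exp s ≤ 3 := by
          have := Real.exp_one_lt_d9
          have h := Real.exp_le_exp.2 (by linarith : s ≤ 1)
          linarith
        have e3 : (p / s) ^ p ≤ (100 * p / a) ^ p * t ^ p := by
          rw [← Real.mul_rpow (by positivity) ht0.le]
          refine Real.rpow_le_rpow (by positivity) ?_ hp0.le
          have : p / s = 2 * p / a * t := by rw [hs]; field_simp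
          rw [this]
          gcongr
          norm_num
        have e4 : 6 ≤ (100 * p / a) ^ (2 : ℝ) := by
          rw [Real.rpow_two]
          have : 100 ≤ 100 * p / a := by
            rw [le_div_iff₀ ha0]; nlinarith
          nlinarith
        calc (p / s) ^ p * Real.exp s * (1 + Real.exp θ)
            ≤ ((100 * p / a) ^ p * t ^ p) * 3 * (2 * Real.exp θ) := by gcongr
          _ = Real.exp θ * ((100 * p / a) ^ p * 6) * t ^ p := by ring
          _ ≤ Real.exp θ * ((100 * p / a) ^ p * (100 * p / a) ^ (2 : ℝ)) * t ^ p := by gcongr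
          _ = _ := by rw [Real.rpow_add (by positivity)]
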